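/- arXiv:1609.05018 — 2 statements merged into one kernel-verified Lean document; each statement's English description precedes it below -/
import Mathlib

section
/- Let C > 0 and let f be a function analytic in the strip {z ∈ ℂ : |Im z| ≤ δ} and bounded there by K·exp(η|z|) for some 0 ≤ η < δ/C and constant K. Then for any ε with Cη < ε < δ, the contour integral ∫ over the curve {x + iε·tanh(x) : x ∈ ℝ} of exp(−z²/(2iC))/√(2πiC) · f(z) dz is absolutely convergent, and its value is independent of the choice of ε in (Cη, δ). -/
open MeasureTheory Real Complex

/-- The regularized contour `x ↦ x + i ε tanh x`. -/
noncomputable def gaussContour (ε x : ℝ) : ℂ := x + Complex.I * ε * Real.tanh x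

/-- Derivative of the contour. -/
noncomputable def gaussContourDeriv (ε x : ℝ) : ℂ :=
  1 + Complex.I * ε * (1 - Real.tanh x ^ 2)

/-- The integrand of the imaginary Gaussian integral of covariance `iC`
along the contour `C_{+,ε}`. -/
noncomputable def imagGaussIntegrand (C ε : ℝ) (f : ℂ → ℂ) (x : ℝ) : ℂ :=
  Complex.exp (-(gaussContour ε x) ^ 2 / (2 * Complex.I * C)) /
      (2 * Real.pi * Complex.I * C) ^ ((1 : ℂ) / 2) *
    f (gaussContour ε x) * gaussContourDeriv ε x

open Filter Topology Set

theorem Real.hasDerivAt_tanh (x : ℝ) : HasDerivAt Real.tanh (1 - Real.tanh x ^ 2) x := by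
  have hne : Real.cosh x ≠ 0 := (Real.cosh_pos x).ne'
  have h := (Real.hasDerivAt_sinh x).div (Real.hasDerivAt_cosh x) hne
  have hfun : Real.tanh = Real.sinh / Real.cosh := by
    funext y
    exact Real.tanh_eq_sinh_div_cosh y
  rw [hfun]
  convert! h using 1
  simp only [Pi.div_apply]
  field_simp

theorem Real.continuous_tanh : Continuous Real.tanh :=
  continuous_iff_continuousAt.2 fun x => (Real.hasDerivAt_tanh x).continuousAt

theorem Real.abs_sub_one_le_mul_tanh (x : ℝ) : |x| - 1 ≤ x * Real.tanh x := by
  have key : ∀ y : ℝ, 0 ≤ y → y - 1 ≤ y * Real.tanh y := by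
    intro y hy
    rw [Real.tanh_eq]
    have hpos := Real.add_one_le_exp y
    have hneg := Real.add_one_le_exp (-y)
    have hprod : Real.exp (-y) * (y + 1) ≤ 1 := by
      calc _ ≤ Real.exp (-y) * Real.exp y := by gcongr
        _ = 1 := by rw [← Real.exp_add]; simp
    have h0 := Real.exp_pos (-y)
    rw [← mul_div_assoc, le_div_iff₀ (by positivity)]
    nlinarith
  rcases le_total 0 x with hx | hx
  · simpa [abs_of_nonneg hx] using key x hx
  · simpa [abs_of_nonpos hx] using key (-x) (by linarith)

theorem integrable_exp_neg_mul_abs {a : ℝ} (ha : 0 < a) :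
    Integrable (fun x : ℝ => Real.exp (-(a * |x|))) := by
  rw [← integrableOn_univ, ← Iic_union_Ioi (a := (0 : ℝ))]
  refine IntegrableOn.union ?_ ?_
  · refine (integrableOn_exp_mul_Iic ha 0).congr_fun (fun x hx => ?_) measurableSet_Iic
    simp [abs_of_nonpos (mem_Iic.1 hx)]
  · refine (integrableOn_exp_mul_Ioi (neg_lt_zero.2 ha) 0).congr_fun (fun x hx => ?_)
      measurableSet_Ioi
    simp [abs_of_pos (mem_Ioi.1 hx)]

theorem tendsto_exp_neg_mul_atTop {a : ℝ} (ha : 0 < a) :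
    Tendsto (fun x : ℝ => Real.exp (-(a * x))) atTop (𝓝 0) :=
  Real.tendsto_exp_neg_atTop_nhds_zero.comp (tendsto_id.const_mul_atTop ha)

theorem gaussContour_re (ε x : ℝ) : (gaussContour ε x).re = x := by
  simp [gaussContour, -ofReal_tanh]

theorem gaussContour_im (ε x : ℝ) : (gaussContour ε x).im = ε * Real.tanh x := by
  simp [gaussContour, -ofReal_tanh]

theorem hasDerivAt_gaussContour (ε x : ℝ) :
    HasDerivAt (gaussContour ε) (gaussContourDeriv ε x) x := by
  have h := (hasDerivAt_id x).ofReal_comp.add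
    ((Real.hasDerivAt_tanh x).ofReal_comp.const_mul (I * ε))
  convert! h using 1
  simp [gaussContourDeriv, -ofReal_tanh]

theorem hasDerivAt_gaussContour_height (ε x : ℝ) :
    HasDerivAt (fun t => gaussContour t x) (I * Real.tanh x) ε := by
  have h := (((hasDerivAt_id ε).ofReal_comp.const_mul I).mul_const (Real.tanh x : ℂ)).const_add
    (x : ℂ)
  convert! h using 1
  simp [-ofReal_tanh]

theorem continuous_gaussContour (ε : ℝ) : Continuous (gaussContour ε) :=
  continuous_iff_continuousAt.2 fun x => (hasDerivAt_gaussContour ε x).continuousAt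

theorem continuous_gaussContourDeriv (ε : ℝ) : Continuous (gaussContourDeriv ε) := by
  have h := continuous_ofReal.comp Real.continuous_tanh
  exact continuous_const.add (continuous_const.mul (continuous_const.sub (h.pow 2)))

theorem norm_gaussContourDeriv_le (ε x : ℝ) : ‖gaussContourDeriv ε x‖ ≤ 1 + |ε| := by
  have h : gaussContourDeriv ε x = 1 + I * ((ε * (1 - Real.tanh x ^ 2) : ℝ) : ℂ) := by
    simp [gaussContourDeriv, -ofReal_tanh, mul_assoc]
  rw [h]
  refine (norm_add_le _ _).trans ?_
  rw [norm_one, norm_mul, norm_I, one_mul, norm_real, Real.norm_eq_abs, abs_mul]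
  have h1 := Real.tanh_sq_lt_one x
  have h2 : |1 - Real.tanh x ^ 2| ≤ 1 :=
    abs_le.2 ⟨by linarith, by linarith [sq_nonneg (Real.tanh x)]⟩
  nlinarith [abs_nonneg ε]

theorem abs_gaussContour_im_lt {δ ε : ℝ} (hε : 0 < ε) (hεδ : ε ≤ δ) (x : ℝ) :
    |(gaussContour ε x).im| < δ := by
  rw [gaussContour_im, abs_mul, abs_of_pos hε]
  nlinarith [Real.abs_tanh_lt_one x]

/-- The holomorphic integrand of the imaginary Gaussian integral of covariance `iC`. -/
noncomputable def imagGaussDensity (C : ℝ) (f : ℂ → ℂ) (z : ℂ) : ℂ :=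
  Complex.exp (-z ^ 2 / (2 * Complex.I * C)) /
      (2 * Real.pi * Complex.I * C) ^ ((1 : ℂ) / 2) * f z

theorem imagGaussIntegrand_eq (C ε : ℝ) (f : ℂ → ℂ) (x : ℝ) :
    imagGaussIntegrand C ε f x =
      imagGaussDensity C f (gaussContour ε x) * gaussContourDeriv ε x :=
  rfl

theorem DifferentiableOn.imagGaussDensity {C : ℝ} {f : ℂ → ℂ} {s : Set ℂ}
    (hf : DifferentiableOn ℂ f s) : DifferentiableOn ℂ (imagGaussDensity C f) s := by
  refine DifferentiableOn.mul (Differentiable.differentiableOn ?_) hf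
  fun_prop

theorem norm_exp_neg_sq_div (C : ℝ) (z : ℂ) :
    ‖Complex.exp (-z ^ 2 / (2 * I * C))‖ = Real.exp (-(z.re * z.im / C)) := by
  rw [Complex.norm_exp]
  congr 1
  have h : -z ^ 2 / (2 * I * C) = (z ^ 2 * I) * ((1 / (2 * C) : ℝ) : ℂ) := by
    rcases eq_or_ne C 0 with rfl | hC
    · simp
    · have : (C : ℂ) ≠ 0 := ofReal_ne_zero.2 hC
      push_cast
      field_simp
      simp
  rw [h, re_mul_ofReal]
  simp [pow_two]
  ring

theorem norm_imagGaussDensity_gaussContour_le {C δ η K ε₀ ε : ℝ} {f : ℂ → ℂ} (hC : 0 < C)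
    (hη : 0 ≤ η) (hε₀ : 0 < ε₀) (hε : ε₀ ≤ ε) (hεδ : ε ≤ δ)
    (hbound : ∀ z : ℂ, |z.im| ≤ δ → ‖f z‖ ≤ K * Real.exp (η * ‖z‖)) (x : ℝ) :
    ‖imagGaussDensity C f (gaussContour ε x)‖ ≤
      K / ‖(2 * Real.pi * Complex.I * C : ℂ) ^ ((1 : ℂ) / 2)‖ * Real.exp (δ / C + η * δ) *
        Real.exp (-((ε₀ / C - η) * |x|)) := by
  have him := (abs_gaussContour_im_lt (hε₀.trans_le hε) hεδ x).le
  have hfz := hbound _ him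
  have hnorm : ‖gaussContour ε x‖ ≤ |x| + δ := by
    refine (norm_le_abs_re_add_abs_im _).trans ?_
    rw [gaussContour_re]
    linarith
  have hK : 0 ≤ K := nonneg_of_mul_nonneg_left ((norm_nonneg _).trans hfz) (Real.exp_pos _)
  have hx : ε₀ * |x| - δ ≤ x * (ε * Real.tanh x) := by
    nlinarith [Real.abs_sub_one_le_mul_tanh x, abs_nonneg x]
  have hexp : Real.exp (-(x * (ε * Real.tanh x) / C)) * Real.exp (η * ‖gaussContour ε x‖) ≤
      Real.exp (δ / C + η * δ) * Real.exp (-((ε₀ / C - η) * |x|)) := by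
    rw [← Real.exp_add, ← Real.exp_add, Real.exp_le_exp]
    have h1 := div_le_div_of_nonneg_right hx hC.le
    have h2 := mul_le_mul_of_nonneg_left hnorm hη
    have h3 : (ε₀ * |x| - δ) / C = ε₀ / C * |x| - δ / C := by ring
    linarith
  rw [imagGaussDensity, norm_mul, norm_div, norm_exp_neg_sq_div, gaussContour_re, gaussContour_im]
  set c := ‖(2 * Real.pi * Complex.I * C : ℂ) ^ ((1 : ℂ) / 2)‖
  calc _ ≤ Real.exp (-(x * (ε * Real.tanh x) / C)) / c *
        (K * Real.exp (η * ‖gaussContour ε x‖)) := by gcongr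
    _ = K / c * (Real.exp (-(x * (ε * Real.tanh x) / C)) *
        Real.exp (η * ‖gaussContour ε x‖)) := by ring
    _ ≤ K / c * (Real.exp (δ / C + η * δ) * Real.exp (-((ε₀ / C - η) * |x|))) := by gcongr
    _ = _ := by ring

theorem continuous_imagGaussIntegrand {C δ ε : ℝ} {f : ℂ → ℂ} (hε : 0 < ε) (hεδ : ε ≤ δ)
    (hf : DifferentiableOn ℂ f {z : ℂ | |z.im| ≤ δ}) :
    Continuous (imagGaussIntegrand C ε f) :=
  (hf.imagGaussDensity.continuousOn.comp_continuous (continuous_gaussContour ε) fun x =>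
    (abs_gaussContour_im_lt hε hεδ x).le).mul (continuous_gaussContourDeriv ε)

theorem integrable_imagGaussIntegrand {C δ η K ε : ℝ} {f : ℂ → ℂ} (hC : 0 < C) (hη : 0 ≤ η)
    (hε : C * η < ε) (hεδ : ε ≤ δ)
    (hf : DifferentiableOn ℂ f {z : ℂ | |z.im| ≤ δ})
    (hbound : ∀ z : ℂ, |z.im| ≤ δ → ‖f z‖ ≤ K * Real.exp (η * ‖z‖)) :
    Integrable (imagGaussIntegrand C ε f) := by
  have hε0 : 0 < ε := (mul_nonneg hC.le hη).trans_lt hε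
  have ha : 0 < ε / C - η := sub_pos.2 ((lt_div_iff₀' hC).2 hε)
  have hle := norm_imagGaussDensity_gaussContour_le hC hη hε0 le_rfl hεδ hbound
  refine Integrable.mono' (((integrable_exp_neg_mul_abs ha).const_mul
      (K / ‖(2 * Real.pi * Complex.I * C : ℂ) ^ ((1 : ℂ) / 2)‖ *
        Real.exp (δ / C + η * δ))).mul_const (1 + |ε|))
    (continuous_imagGaussIntegrand hε0 hεδ hf).aestronglyMeasurable
    (Eventually.of_forall fun x => ?_)
  rw [imagGaussIntegrand_eq, norm_mul]
  exact mul_le_mul (hle x) (norm_gaussContourDeriv_le ε x) (norm_nonneg _)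
    ((norm_nonneg _).trans (hle x))

theorem convex_abs_im_le (δ : ℝ) : Convex ℝ {z : ℂ | |z.im| ≤ δ} := by
  have h : {z : ℂ | |z.im| ≤ δ} = imLm ⁻¹' Icc (-δ) δ := by
    ext z
    simp [abs_le]
  rw [h]
  exact (convex_Icc _ _).is_linear_preimage imLm.isLinear

theorem exists_primitive_of_strip {δ : ℝ} {h : ℂ → ℂ}
    (hh : DifferentiableOn ℂ h {z : ℂ | |z.im| ≤ δ}) :
    ∃ G : ℂ → ℂ, ∀ z : ℂ, |z.im| < δ → HasDerivAt G (h z) z := by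
  obtain ⟨G, hG⟩ := (convex_abs_im_le δ).exists_forall_hasDerivWithinAt hh
  refine ⟨G, fun z hz => (hG z hz.le).hasDerivAt ?_⟩
  have hopen : IsOpen {z : ℂ | |z.im| < δ} := isOpen_lt (by fun_prop) continuous_const
  exact mem_of_superset (hopen.mem_nhds hz) fun w (hw : |w.im| < δ) => hw.le

theorem integral_imagGaussIntegrand_eq {C δ η K ε₁ ε₂ : ℝ} {f : ℂ → ℂ} (hC : 0 < C) (hη : 0 ≤ η)
    (hf : DifferentiableOn ℂ f {z : ℂ | |z.im| ≤ δ})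
    (hbound : ∀ z : ℂ, |z.im| ≤ δ → ‖f z‖ ≤ K * Real.exp (η * ‖z‖))
    (hε₁ : C * η < ε₁) (hε₁δ : ε₁ ≤ δ) (hε₂ : C * η < ε₂) (hε₂δ : ε₂ ≤ δ) :
    ∫ x : ℝ, imagGaussIntegrand C ε₁ f x = ∫ x : ℝ, imagGaussIntegrand C ε₂ f x := by
  obtain ⟨G, hG⟩ := exists_primitive_of_strip (hf.imagGaussDensity (C := C))
  have hCη : 0 ≤ C * η := mul_nonneg hC.le hη
  have hinterval : ∀ ε, C * η < ε → ε ≤ δ → ∀ R : ℝ,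
      ∫ x in -R..R, imagGaussIntegrand C ε f x =
        G (gaussContour ε R) - G (gaussContour ε (-R)) := by
    intro ε hε hεδ R
    have hε0 := hCη.trans_lt hε
    refine intervalIntegral.integral_eq_sub_of_hasDerivAt (f := G ∘ gaussContour ε) (fun x _ => ?_)
      ((continuous_imagGaussIntegrand hε0 hεδ hf).intervalIntegrable _ _)
    rw [imagGaussIntegrand_eq, mul_comm]
    exact (hG _ (abs_gaussContour_im_lt hε0 hεδ x)).scomp x (hasDerivAt_gaussContour ε x)
  set ε₀ := min ε₁ ε₂
  have hε₀ : C * η < ε₀ := lt_min hε₁ hε₂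
  have ha : 0 < ε₀ / C - η := sub_pos.2 ((lt_div_iff₀' hC).2 hε₀)
  set A := K / ‖(2 * Real.pi * Complex.I * C : ℂ) ^ ((1 : ℂ) / 2)‖ * Real.exp (δ / C + η * δ)
  have hside : ∀ x : ℝ, ‖G (gaussContour ε₁ x) - G (gaussContour ε₂ x)‖ ≤
      A * Real.exp (-((ε₀ / C - η) * |x|)) * ‖ε₁ - ε₂‖ := by
    intro x
    refine (convex_Icc ε₀ δ).norm_image_sub_le_of_norm_hasDerivWithin_le
      (f := fun t => G (gaussContour t x))
      (f' := fun t => (I * Real.tanh x : ℂ) • imagGaussDensity C f (gaussContour t x))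
      (fun t ht => ?_) (fun t ht => ?_) ⟨min_le_right _ _, hε₂δ⟩ ⟨min_le_left _ _, hε₁δ⟩
    · have him := abs_gaussContour_im_lt ((hCη.trans_lt hε₀).trans_le ht.1) ht.2 x
      exact ((hG _ him).scomp t (hasDerivAt_gaussContour_height t x)).hasDerivWithinAt
    · have hle := norm_imagGaussDensity_gaussContour_le hC hη (hCη.trans_lt hε₀) ht.1 ht.2 hbound x
      rw [norm_smul, norm_mul, norm_I, one_mul, norm_real, Real.norm_eq_abs]
      exact (mul_le_of_le_one_left (norm_nonneg _) (Real.abs_tanh_lt_one x).le).trans hle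
  have hlim : Tendsto (fun R : ℝ => (∫ x in -R..R, imagGaussIntegrand C ε₁ f x) -
      ∫ x in -R..R, imagGaussIntegrand C ε₂ f x) atTop (𝓝 0) := by
    have hbd : Tendsto (fun R : ℝ => 2 * (A * Real.exp (-((ε₀ / C - η) * R)) * ‖ε₁ - ε₂‖))
        atTop (𝓝 0) := by
      simpa using (((tendsto_exp_neg_mul_atTop ha).const_mul A).mul_const ‖ε₁ - ε₂‖).const_mul 2
    refine squeeze_zero_norm' ?_ hbd
    filter_upwards [eventually_ge_atTop 0] with R hR
    rw [hinterval ε₁ hε₁ hε₁δ, hinterval ε₂ hε₂ hε₂δ, sub_sub_sub_comm]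
    have h1 := hside R
    have h2 := hside (-R)
    rw [abs_neg] at h2
    rw [abs_of_nonneg hR] at h1 h2
    exact (norm_sub_le _ _).trans (by linarith)
  have hconv := fun ε hε hεδ => intervalIntegral_tendsto_integral
    (integrable_imagGaussIntegrand (ε := ε) hC hη hε hεδ hf hbound)
    tendsto_neg_atTop_atBot tendsto_id
  exact sub_eq_zero.1 (tendsto_nhds_unique
    ((hconv ε₁ hε₁ hε₁δ).sub (hconv ε₂ hε₂ hε₂δ)) hlim)

/-- for `f` analytic and exponentially bounded in the strip `|Im z| ≤ δ`,
the imaginary Gaussian contour integral of covariance `iC` is absolutely convergent for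
every `ε ∈ (Cη, δ)` and its value does not depend on the choice of `ε`. -/
theorem imagGaussIntegral_integrable_and_contour_independent
    (C δ η K : ℝ) (hC : 0 < C) (hη : 0 ≤ η) (hηδ : C * η < δ)
    (f : ℂ → ℂ)
    (hf : DifferentiableOn ℂ f {z : ℂ | |z.im| ≤ δ})
    (hbound : ∀ z : ℂ, |z.im| ≤ δ → ‖f z‖ ≤ K * Real.exp (η * ‖z‖)) :
    (∀ ε : ℝ, C * η < ε → ε < δ → Integrable (imagGaussIntegrand C ε f)) ∧
    (∀ ε₁ ε₂ : ℝ, C * η < ε₁ → ε₁ < δ → C * η < ε₂ → ε₂ < δ →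
      ∫ x : ℝ, imagGaussIntegrand C ε₁ f x = ∫ x : ℝ, imagGaussIntegrand C ε₂ f x) := by
  exact ⟨fun _ h hδ => integrable_imagGaussIntegrand hC hη h hδ.le hf hbound,
    fun _ _ h₁ hδ₁ h₂ hδ₂ =>
      integral_imagGaussIntegrand_eq hC hη hf hbound h₁ hδ₁.le h₂ hδ₂.le⟩
end

section
/- For real C > 0 and a ∈ ℂ with C|a| < ε < δ, the imaginary Gaussian integral of exp(a x) with covariance ±iC is absolutely convergent and equals exp(±iCa²/2). -/
open MeasureTheory Real Complex

/-- The regularized contour `x ↦ x + s·i ε tanh x`, where `s = ±1`. -/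
noncomputable def gaussContourS (s ε x : ℝ) : ℂ := x + s * Complex.I * ε * Real.tanh x

/-- Derivative of the contour. -/
noncomputable def gaussContourSDeriv (s ε x : ℝ) : ℂ :=
  1 + s * Complex.I * ε * (1 - Real.tanh x ^ 2)

open Filter Topology Set

namespace ImagGauss

theorem abs_sub_one_le_mul_tanh (x : ℝ) : |x| - 1 ≤ x * Real.tanh x := by
  have key : ∀ y : ℝ, 0 ≤ y → y - 1 ≤ y * Real.tanh y := fun y hy => by
    rw [Real.tanh_eq, mul_div_assoc', le_div_iff₀ (by positivity)]
    have h₁ := Real.add_one_le_exp y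
    have h₂ : 2 * y * Real.exp (-y) ≤ 2 := by
      have h₃ : Real.exp y * Real.exp (-y) = 1 := by rw [← Real.exp_add]; simp
      nlinarith [Real.exp_pos (-y)]
    linarith [Real.cosh_eq y, Real.one_le_cosh y]
  rcases le_total 0 x with hx | hx
  · simpa [abs_of_nonneg hx] using key x hx
  · simpa [abs_of_nonpos hx] using key (-x) (by linarith)

theorem hasDerivAt_tanh (x : ℝ) : HasDerivAt Real.tanh (1 - Real.tanh x ^ 2) x := by
  have h : Real.tanh = fun y => Real.sinh y / Real.cosh y :=
    funext Real.tanh_eq_sinh_div_cosh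
  have hc := (Real.cosh_pos x).ne'
  rw [h]
  refine ((Real.hasDerivAt_sinh x).fun_div (Real.hasDerivAt_cosh x) hc).congr_deriv ?_
  field_simp

theorem continuous_tanh : Continuous Real.tanh :=
  continuous_iff_continuousAt.2 fun x => (hasDerivAt_tanh x).continuousAt

theorem hasDerivAt_gaussContourS (s ε x : ℝ) :
    HasDerivAt (gaussContourS s ε) (gaussContourSDeriv s ε x) x := by
  unfold gaussContourS gaussContourSDeriv
  have h := (hasDerivAt_tanh x).ofReal_comp.const_mul ((s : ℂ) * I * ε)
  simpa using (hasDerivAt_id x).ofReal_comp.fun_add h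

theorem continuous_gaussContourS (s ε : ℝ) : Continuous (gaussContourS s ε) :=
  continuous_iff_continuousAt.2 fun x => (hasDerivAt_gaussContourS s ε x).continuousAt

theorem continuous_gaussContourSDeriv (s ε : ℝ) : Continuous (gaussContourSDeriv s ε) := by
  have := continuous_tanh
  unfold gaussContourSDeriv
  fun_prop

/-- The unnormalized Gaussian weight of covariance `s i C` times `exp (a z)`. -/
noncomputable def weight (C s : ℝ) (a z : ℂ) : ℂ :=
  Complex.exp (-z ^ 2 / (s * 2 * I * C)) * Complex.exp (a * z)

theorem differentiable_weight (C s : ℝ) (a : ℂ) : Differentiable ℂ (weight C s a) := by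
  unfold weight
  fun_prop

theorem norm_weight_le {C s : ℝ} (hC : 0 < C) (hs : s = 1 ∨ s = -1) (a : ℂ) (x y : ℝ) :
    ‖weight C s a (x + s * I * y)‖ ≤ Real.exp (-(x * y) / C + ‖a‖ * (|x| + |y|)) := by
  have hC' : (C : ℂ) ≠ 0 := by exact_mod_cast hC.ne'
  have hq : -((x : ℂ) + s * I * y) ^ 2 / (s * 2 * I * C) =
      ((-(x * y) / C : ℝ) : ℂ) + ((s * (x ^ 2 - y ^ 2) / (2 * C) : ℝ) : ℂ) * I := by
    rcases hs with rfl | rfl <;> push_cast <;> field_simp <;> ring_nf <;>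
      simp only [I_sq] <;> ring
  have hz : ‖(x : ℂ) + s * I * y‖ ≤ |x| + |y| := by
    refine (norm_add_le _ _).trans_eq ?_
    rcases hs with rfl | rfl <;> simp
  rw [weight, norm_mul, Complex.norm_exp, Complex.norm_exp, ← Real.exp_add, hq]
  refine Real.exp_le_exp.2 (add_le_add (by rw [add_re, re_ofReal_mul]; simp) ?_)
  exact (re_le_norm _).trans (by rw [norm_mul]; gcongr)

section

variable {C ε s : ℝ} {a : ℂ}

theorem exponent_tanh_le (hC : 0 < C) (hε : 0 < ε) (x : ℝ) :
    -(x * (ε * Real.tanh x)) / C + ‖a‖ * |ε * Real.tanh x| ≤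
      -(ε / C) * |x| + (ε / C + ‖a‖ * ε) := by
  have h₁ := mul_le_mul_of_nonneg_left (abs_sub_one_le_mul_tanh x) (div_pos hε hC).le
  have h₂ : ‖a‖ * |ε * Real.tanh x| ≤ ‖a‖ * ε := by
    rw [abs_mul, abs_of_pos hε]
    gcongr
    exact mul_le_of_le_one_right hε.le (Real.abs_tanh_lt_one x).le
  have h₃ : -(x * (ε * Real.tanh x)) / C = -(ε / C * (x * Real.tanh x)) := by ring
  linarith

theorem exponent_diag_le (hC : 0 < C) {x : ℝ} (hx : ε ≤ |x|) (hx' : C * ‖a‖ ≤ |x|) :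
    -(x * x) / C + ‖a‖ * |x| ≤ -(ε / C) * |x| + ‖a‖ * ε := by
  have h₁ : 0 ≤ |x| / C - ‖a‖ := by
    rw [sub_nonneg, le_div_iff₀ hC]; linarith
  have h₂ := mul_le_mul_of_nonneg_left hx h₁
  have h₃ : -(x * x) / C = -(|x| / C * |x|) := by rw [← abs_mul_abs_self x]; ring
  have h₄ : -(ε / C) * |x| = -(|x| / C * ε) := by ring
  linarith

theorem norm_weight_contour_le (hC : 0 < C) (hs : s = 1 ∨ s = -1) (hε : 0 < ε) (x : ℝ) :
    ‖weight C s a (gaussContourS s ε x)‖ ≤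
      Real.exp (ε / C + ‖a‖ * ε) * Real.exp (-((ε / C - ‖a‖) * |x|)) := by
  have h := norm_weight_le hC hs a x (ε * Real.tanh x)
  have hz : gaussContourS s ε x = x + s * I * (ε * Real.tanh x : ℝ) := by
    rw [gaussContourS]; push_cast; ring
  rw [hz]
  refine h.trans ?_
  rw [← Real.exp_add]
  refine Real.exp_le_exp.2 ?_
  linarith [exponent_tanh_le (a := a) hC hε x]

/-- On the segment joining the contour to the rotated line, the weight decays uniformly. -/
theorem norm_weight_segment_le (hC : 0 < C) (hs : s = 1 ∨ s = -1) (hε : 0 < ε) {x : ℝ}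
    (hx : ε ≤ |x|) (hx' : C * ‖a‖ ≤ |x|) {z : ℂ}
    (hz : z ∈ segment ℝ ((1 + s * I) * x) (gaussContourS s ε x)) :
    ‖weight C s a z‖ ≤
      Real.exp (ε / C + ‖a‖ * ε) * Real.exp (-((ε / C - ‖a‖) * |x|)) := by
  obtain ⟨v, u, hv, hu, huv, rfl⟩ := hz
  have hz : v • ((1 + s * I) * x : ℂ) + u • gaussContourS s ε x =
      x + s * I * (u * (ε * Real.tanh x) + v * x : ℝ) := by
    have huv' : (v : ℂ) = 1 - u := by rw [eq_sub_of_add_eq huv]; simp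
    simp only [gaussContourS, real_smul]
    push_cast
    rw [huv']
    ring
  rw [hz]
  refine (norm_weight_le hC hs a x _).trans ?_
  rw [← Real.exp_add]
  refine Real.exp_le_exp.2 ?_
  have h₁ := mul_le_mul_of_nonneg_left (exponent_tanh_le (a := a) hC hε x) hu
  have h₂ := mul_le_mul_of_nonneg_left (exponent_diag_le (a := a) hC hx hx') hv
  have h₃ : |u * (ε * Real.tanh x) + v * x| ≤ u * |ε * Real.tanh x| + v * |x| := by
    refine (abs_add_le _ _).trans_eq ?_
    rw [abs_mul u, abs_mul v, abs_of_nonneg hu, abs_of_nonneg hv]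
  have h₄ := mul_le_mul_of_nonneg_left h₃ (norm_nonneg a)
  have h₅ : -(x * (u * (ε * Real.tanh x) + v * x)) / C =
      u * (-(x * (ε * Real.tanh x)) / C) + v * (-(x * x) / C) := by ring
  have h₆ : 0 ≤ v * (ε / C) := mul_nonneg hv (div_pos hε hC).le
  obtain rfl : u = 1 - v := by linarith
  rw [h₅]
  linarith

theorem integrable_exp_neg_mul_abs {c : ℝ} (hc : 0 < c) :
    Integrable fun x : ℝ => Real.exp (-(c * |x|)) := by
  refine (integrable_inv_one_add_sq.const_mul (1 + 2 / c ^ 2)).mono'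
    (by fun_prop : Continuous _).aestronglyMeasurable (ae_of_all _ fun x => ?_)
  have h₁ : 0 ≤ c * |x| := mul_nonneg hc.le (abs_nonneg x)
  have h := Real.quadratic_le_exp_of_nonneg h₁
  rw [Real.norm_of_nonneg (Real.exp_pos _).le, Real.exp_neg, ← div_eq_mul_inv,
    le_div_iff₀ (by positivity), inv_mul_le_iff₀ (Real.exp_pos _)]
  have h₂ : x ^ 2 = 2 / c ^ 2 * ((c * |x|) ^ 2 / 2) := by
    rw [mul_pow, sq_abs]; field_simp
  have h₃ : x ^ 2 ≤ 2 / c ^ 2 * Real.exp (c * |x|) := by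
    rw [h₂]
    gcongr
    linarith
  nlinarith [sq_nonneg (c * |x|)]

theorem norm_gaussContourSDeriv_le (hs : s = 1 ∨ s = -1) (hε : 0 < ε) (x : ℝ) :
    ‖gaussContourSDeriv s ε x‖ ≤ 1 + ε := by
  have h₁ : (1 - (Real.tanh x : ℂ) ^ 2) = ((1 - Real.tanh x ^ 2 : ℝ) : ℂ) := by push_cast; ring
  have h₂ : |1 - Real.tanh x ^ 2| ≤ 1 := by
    have := Real.tanh_sq_lt_one x
    rw [abs_of_nonneg] <;> nlinarith [sq_nonneg (Real.tanh x)]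
  have h₃ : ‖(s : ℂ) * I * ε‖ = ε := by
    rcases hs with rfl | rfl <;> simp [abs_of_pos hε]
  rw [gaussContourSDeriv, h₁]
  refine (norm_add_le _ _).trans ?_
  rw [norm_mul, h₃, norm_one, norm_real, Real.norm_eq_abs]
  nlinarith

theorem integrable_contour (hC : 0 < C) (hs : s = 1 ∨ s = -1) (hε : C * ‖a‖ < ε) :
    Integrable fun x : ℝ => weight C s a (gaussContourS s ε x) * gaussContourSDeriv s ε x := by
  have hε₀ : 0 < ε := lt_of_le_of_lt (by positivity) hε
  have hc : 0 < ε / C - ‖a‖ := by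
    rw [sub_pos, lt_div_iff₀ hC]; linarith
  refine (((integrable_exp_neg_mul_abs hc).const_mul
    (Real.exp (ε / C + ‖a‖ * ε))).mul_const (1 + ε)).mono' ?_ (ae_of_all _ fun x => ?_)
  · exact (((differentiable_weight C s a).continuous.comp (continuous_gaussContourS s ε)).mul
      (continuous_gaussContourSDeriv s ε)).aestronglyMeasurable
  · rw [norm_mul]
    exact mul_le_mul (norm_weight_contour_le hC hs hε₀ x) (norm_gaussContourSDeriv_le hs hε₀ x)
      (norm_nonneg _) (by positivity)

theorem weight_rotated (hC : 0 < C) (hs : s = 1 ∨ s = -1) (x : ℝ) :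
    weight C s a ((1 + s * I) * x) =
      Complex.exp (-(1 / C : ℂ) * x ^ 2 + a * (1 + s * I) * x + 0) := by
  have hC' : (C : ℂ) ≠ 0 := by exact_mod_cast hC.ne'
  have h : -((1 + s * I) * x : ℂ) ^ 2 / (s * 2 * I * C) = -(1 / C : ℂ) * x ^ 2 := by
    rcases hs with rfl | rfl <;> push_cast <;> field_simp <;> ring_nf <;>
      simp only [I_sq] <;> ring
  rw [weight, ← Complex.exp_add, h]
  ring_nf

theorem re_neg_one_div_ofReal_neg (hC : 0 < C) : (-(1 / C : ℂ)).re < 0 := by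
  rw [← ofReal_one, ← ofReal_div, neg_re, ofReal_re, neg_lt_zero]
  positivity

theorem integrable_rotated (hC : 0 < C) (hs : s = 1 ∨ s = -1) :
    Integrable fun x : ℝ => weight C s a ((1 + s * I) * x) * (1 + s * I) := by
  simp_rw [weight_rotated hC hs]
  exact (integrable_cexp_quadratic' (re_neg_one_div_ofReal_neg hC) _ _).mul_const _

theorem cpow_half_eq (hC : 0 < C) (hs : s = 1 ∨ s = -1) :
    (s * 2 * Real.pi * I * C : ℂ) ^ ((1 : ℂ) / 2) = (1 + s * I) * (√(π * C) : ℝ) := by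
  have h₀ : 0 < √(π * C) := Real.sqrt_pos.2 (by positivity)
  have h : (s * 2 * Real.pi * I * C : ℂ) = ((1 + s * I) * (√(π * C) : ℝ)) ^ 2 := by
    rw [mul_pow, ← ofReal_pow, Real.sq_sqrt (by positivity)]
    rcases hs with rfl | rfl <;> push_cast <;> ring_nf <;> simp only [I_sq] <;> ring
  rw [h, one_div, sq_cpow_two_inv]
  simpa using h₀

theorem integral_rotated (hC : 0 < C) (hs : s = 1 ∨ s = -1) :
    ∫ x : ℝ, weight C s a ((1 + s * I) * x) * (1 + s * I) =
      (s * 2 * Real.pi * I * C : ℂ) ^ ((1 : ℂ) / 2) * Complex.exp (s * I * C * a ^ 2 / 2) := by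
  have hC' : (C : ℂ) ≠ 0 := by exact_mod_cast hC.ne'
  have h₁ : (π / -(-(1 / C)) : ℂ) ^ (1 / 2 : ℂ) = (√(π * C) : ℝ) := by
    rw [Real.sqrt_eq_rpow, ofReal_cpow (by positivity)]
    push_cast
    field_simp
  have h₂ : (0 - (a * (1 + s * I)) ^ 2 / (4 * -(1 / C)) : ℂ) = s * I * C * a ^ 2 / 2 := by
    rcases hs with rfl | rfl <;> push_cast <;> field_simp <;> ring_nf <;>
      simp only [I_sq] <;> ring
  simp_rw [weight_rotated hC hs]
  rw [integral_mul_const, integral_cexp_quadratic (re_neg_one_div_ofReal_neg hC), h₁, h₂,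
    cpow_half_eq hC hs]
  ring

theorem norm_gaussContourS_sub_le (hs : s = 1 ∨ s = -1) (hε : 0 < ε) (x : ℝ) :
    ‖gaussContourS s ε x - (1 + s * I) * x‖ ≤ ε + |x| := by
  have h : gaussContourS s ε x - (1 + s * I) * x = s * I * (ε * Real.tanh x - x : ℝ) := by
    rw [gaussContourS]; push_cast; ring
  have h' : ‖(s : ℂ) * I‖ = 1 := by rcases hs with rfl | rfl <;> simp
  rw [h, norm_mul, h', one_mul, norm_real, Real.norm_eq_abs]
  refine (abs_sub _ _).trans ?_
  rw [abs_mul, abs_of_pos hε]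
  gcongr
  exact mul_le_of_le_one_right hε.le (Real.abs_tanh_lt_one x).le

theorem tendsto_endpoint_bound {c : ℝ} (hc : 0 < c) (K ε : ℝ) :
    Tendsto (fun R : ℝ => K * Real.exp (-(c * R)) * (ε + R)) atTop (𝓝 0) := by
  have h : Tendsto (fun R : ℝ => c * R) atTop atTop := tendsto_id.const_mul_atTop hc
  have h₀ := (Real.tendsto_pow_mul_exp_neg_atTop_nhds_zero 0).comp h
  have h₁ := (Real.tendsto_pow_mul_exp_neg_atTop_nhds_zero 1).comp h
  have := (h₀.const_mul (K * ε)).add (h₁.const_mul (K / c))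
  simp only [mul_zero, add_zero] at this
  refine this.congr fun R => ?_
  simp only [Function.comp_apply]
  field_simp

theorem integral_contour_eq_integral_rotated (hC : 0 < C) (hs : s = 1 ∨ s = -1)
    (hε : C * ‖a‖ < ε) :
    ∫ x : ℝ, weight C s a (gaussContourS s ε x) * gaussContourSDeriv s ε x =
      ∫ x : ℝ, weight C s a ((1 + s * I) * x) * (1 + s * I) := by
  have hε₀ : 0 < ε := lt_of_le_of_lt (by positivity) hε
  have hc : 0 < ε / C - ‖a‖ := by
    rw [sub_pos, lt_div_iff₀ hC]; linarith
  obtain ⟨G, hG⟩ := (differentiable_weight C s a).isExactOn_univ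
  have hG' : ∀ z, HasDerivAt G (weight C s a z) z := fun z => hG z (mem_univ z)
  set K := Real.exp (ε / C + ‖a‖ * ε)
  set B : ℝ → ℝ := fun R => K * Real.exp (-((ε / C - ‖a‖) * R)) * (ε + R)
  have hend : ∀ x : ℝ, ε ≤ |x| →
      ‖G (gaussContourS s ε x) - G ((1 + s * I) * x)‖ ≤ B |x| := fun x hx => by
    refine ((convex_segment ((1 + s * I) * x : ℂ)
      (gaussContourS s ε x)).norm_image_sub_le_of_norm_hasDerivWithin_le
      (fun z _ => (hG' z).hasDerivWithinAt)
      (fun z hz => norm_weight_segment_le hC hs hε₀ hx (hε.le.trans hx) hz)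
      (left_mem_segment ℝ _ _) (right_mem_segment ℝ _ _)).trans ?_
    exact mul_le_mul_of_nonneg_left (norm_gaussContourS_sub_le hs hε₀ x) (by positivity)
  have hf := integrable_contour (a := a) hC hs hε
  have hg := integrable_rotated (a := a) hC hs
  have hline : ∀ x : ℝ, HasDerivAt (fun x : ℝ => ((1 + s * I) * x : ℂ)) (1 + s * I) x :=
    fun x => by simpa using (hasDerivAt_id x).ofReal_comp.const_mul (1 + s * I : ℂ)
  have hfR : ∀ R : ℝ, ∫ x in -R..R,
      weight C s a (gaussContourS s ε x) * gaussContourSDeriv s ε x =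
        G (gaussContourS s ε R) - G (gaussContourS s ε (-R)) := fun R =>
    intervalIntegral.integral_eq_sub_of_hasDerivAt (f := fun x => G (gaussContourS s ε x))
      (fun x _ => (hG' _).comp x (hasDerivAt_gaussContourS s ε x)) hf.intervalIntegrable
  have hgR : ∀ R : ℝ, ∫ x in -R..R, weight C s a ((1 + s * I) * x) * (1 + s * I) =
        G ((1 + s * I) * R) - G ((1 + s * I) * (-R : ℝ)) := fun R =>
    intervalIntegral.integral_eq_sub_of_hasDerivAt (f := fun x : ℝ => G ((1 + s * I) * x))
      (fun x _ => (hG' _).comp x (hline x)) hg.intervalIntegrable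
  have hlim := (intervalIntegral_tendsto_integral hf tendsto_neg_atTop_atBot tendsto_id).sub
    (intervalIntegral_tendsto_integral hg tendsto_neg_atTop_atBot tendsto_id)
  refine sub_eq_zero.1 (tendsto_nhds_unique hlim ?_)
  have hB0 : Tendsto (fun R => B R + B R) atTop (𝓝 0) := by
    simpa using (tendsto_endpoint_bound hc K ε).add (tendsto_endpoint_bound hc K ε)
  refine squeeze_zero_norm' ?_ hB0
  filter_upwards [eventually_ge_atTop ε] with R hR
  have hR₀ : |R| = R := abs_of_nonneg (hε₀.le.trans hR)
  have h₁ := hend R (by rwa [hR₀])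
  have h₂ := hend (-R) (by rwa [abs_neg, hR₀])
  rw [abs_neg, hR₀] at h₂
  rw [hR₀] at h₁
  simp only [id_eq]
  rw [hfR, hgR, sub_sub_sub_comm]
  exact (norm_sub_le _ _).trans (add_le_add h₁ h₂)

end

end ImagGauss

/-- for `C > 0` and `a ∈ ℂ` with `C‖a‖ < ε < δ`, the imaginary Gaussian
integral of `exp (a x)` with covariance `± i C` is absolutely convergent and equals
`exp (± i C a² / 2)`. -/
theorem imagGauss_exp_linear (C δ : ℝ) (hC : 0 < C) (a : ℂ) (s : ℝ) (hs : s = 1 ∨ s = -1)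
    (ε : ℝ) (hε : C * ‖a‖ < ε) (hεδ : ε < δ) :
    Integrable (fun x : ℝ =>
      Complex.exp (-(gaussContourS s ε x) ^ 2 / (s * 2 * Complex.I * C)) /
          (s * 2 * Real.pi * Complex.I * C) ^ ((1 : ℂ) / 2) *
        Complex.exp (a * gaussContourS s ε x) * gaussContourSDeriv s ε x) ∧
    (∫ x : ℝ,
      Complex.exp (-(gaussContourS s ε x) ^ 2 / (s * 2 * Complex.I * C)) /
          (s * 2 * Real.pi * Complex.I * C) ^ ((1 : ℂ) / 2) *
        Complex.exp (a * gaussContourS s ε x) * gaussContourSDeriv s ε x)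
      = Complex.exp (s * Complex.I * C * a ^ 2 / 2) := by
  have hD : (s * 2 * Real.pi * I * C : ℂ) ^ ((1 : ℂ) / 2) ≠ 0 := by
    rw [Complex.cpow_ne_zero_iff]
    left
    rcases hs with rfl | rfl <;> simp [hC.ne', Real.pi_ne_zero]
  have hfun : ∀ x : ℝ, Complex.exp (-(gaussContourS s ε x) ^ 2 / (s * 2 * Complex.I * C)) /
          (s * 2 * Real.pi * Complex.I * C) ^ ((1 : ℂ) / 2) *
        Complex.exp (a * gaussContourS s ε x) * gaussContourSDeriv s ε x =
      ((s * 2 * Real.pi * Complex.I * C : ℂ) ^ ((1 : ℂ) / 2))⁻¹ *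
        (ImagGauss.weight C s a (gaussContourS s ε x) * gaussContourSDeriv s ε x) := fun x => by
    rw [ImagGauss.weight, div_eq_mul_inv]
    ring
  simp_rw [hfun]
  refine ⟨(ImagGauss.integrable_contour hC hs hε).const_mul _, ?_⟩
  rw [integral_const_mul, ImagGauss.integral_contour_eq_integral_rotated hC hs hε,
    ImagGauss.integral_rotated hC hs, inv_mul_cancel_left₀ hD]
end
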